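/- arXiv:2311.13115 — 2 statements merged into one kernel-verified Lean document; each statement's English description precedes it below -/
import Mathlib

section
/- Let d ≥ 3. Let l₁, l₂ be nonzero linear binary forms over ℂ that are not proportional to each other, and let m₁, m₂ be linear forms such that mᵢ is not a complex scalar multiple of lᵢ (i = 1, 2). Then the four binary forms l₁^d, l₁^{d−1}m₁, l₂^d, l₂^{d−1}m₂ are linearly independent over ℂ in ℂ[X₀,X₁]. -/
open MvPolynomial

/-- The linear binary form `a·X₀ + b·X₁` in `ℂ[X₀,X₁]`. -/
noncomputable def linForm (a b : ℂ) : MvPolynomial (Fin 2) ℂ :=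
  MvPolynomial.C a * MvPolynomial.X 0 + MvPolynomial.C b * MvPolynomial.X 1

theorem eval_linForm (a b : ℂ) (v : Fin 2 → ℂ) :
    MvPolynomial.eval v (linForm a b) = a * v 0 + b * v 1 := by
  simp [linForm]

/-- A linear form that is not a multiple of `a·X₀ + b·X₁` does not vanish at its zero `(b, -a)`. -/
theorem mul_sub_mul_ne_zero_of_linForm_ne_smul {a b p q : ℂ} (hl : (a, b) ≠ (0, 0))
    (hm : ∀ c : ℂ, linForm p q ≠ c • linForm a b) : p * b - q * a ≠ 0 := by
  intro h
  have key (c : ℂ) (hp : p = c * a) (hq : q = c * b) : False := by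
    refine hm c ?_
    simp only [linForm, hp, hq, MvPolynomial.smul_eq_C_mul, map_mul]
    ring
  by_cases ha : a = 0
  · have hb : b ≠ 0 := fun hb => hl (by rw [ha, hb])
    refine key (q / b) ?_ ?_
    · field_simp
      linear_combination h
    · field_simp
  · refine key (p / a) ?_ ?_
    · field_simp
    · field_simp
      linear_combination -h

/-- Let `d ≥ 3`, let `l₁, l₂` be nonzero non-proportional linear binary forms, and let
`mᵢ` be a linear form that is not a complex scalar multiple of `lᵢ` (i = 1,2). Then
`l₁^d, l₁^{d-1}m₁, l₂^d, l₂^{d-1}m₂` are linearly independent over `ℂ`. -/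
theorem confluent_powers_linearIndependent
    (d : ℕ) (hd : 3 ≤ d)
    (a₁ b₁ a₂ b₂ p₁ q₁ p₂ q₂ : ℂ)
    (hl₁ : (a₁, b₁) ≠ (0, 0)) (hl₂ : (a₂, b₂) ≠ (0, 0))
    (hl₁l₂ : ∀ c : ℂ, linForm a₁ b₁ ≠ c • linForm a₂ b₂)
    (hl₂l₁ : ∀ c : ℂ, linForm a₂ b₂ ≠ c • linForm a₁ b₁)
    (hm₁ : ∀ c : ℂ, linForm p₁ q₁ ≠ c • linForm a₁ b₁)
    (hm₂ : ∀ c : ℂ, linForm p₂ q₂ ≠ c • linForm a₂ b₂) :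
    LinearIndependent ℂ
      ![(linForm a₁ b₁) ^ d, (linForm a₁ b₁) ^ (d - 1) * linForm p₁ q₁,
        (linForm a₂ b₂) ^ d, (linForm a₂ b₂) ^ (d - 1) * linForm p₂ q₂] := by
  have hD := mul_sub_mul_ne_zero_of_linForm_ne_smul hl₂ hl₁l₂
  have hM₁ := mul_sub_mul_ne_zero_of_linForm_ne_smul hl₁ hm₁
  have hM₂ := mul_sub_mul_ne_zero_of_linForm_ne_smul hl₂ hm₂
  obtain ⟨n, rfl⟩ : ∃ n, d = n + 3 := ⟨d - 3, by omega⟩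
  rw [Fintype.linearIndependent_iff]
  intro g hg
  set D := a₁ * b₂ - b₁ * a₂ with hD_def
  -- restrict the relation to the coordinates dual to the zeros of the two forms
  have hev (s t : ℂ) :
      (t * D) ^ (n + 2) * (g 0 * (t * D) +
        g 1 * (s * (p₁ * b₁ - q₁ * a₁) + t * (p₁ * b₂ - q₁ * a₂))) +
      (-s * D) ^ (n + 2) * (g 2 * (-s * D) +
        g 3 * (s * (p₂ * b₁ - q₂ * a₁) + t * (p₂ * b₂ - q₂ * a₂))) = 0 := by
    have h := congrArg (MvPolynomial.eval ![s * b₁ + t * b₂, -(s * a₁ + t * a₂)]) hg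
    simp only [Fin.sum_univ_four, Matrix.cons_val, map_add, MvPolynomial.smul_eval, map_mul,
      map_pow, eval_linForm, map_zero,
      show n + 3 - 1 = n + 2 by omega] at h
    have e₁ : a₁ * (s * b₁ + t * b₂) + b₁ * -(s * a₁ + t * a₂) = t * D := by
      rw [hD_def]; ring
    have e₂ : a₂ * (s * b₁ + t * b₂) + b₂ * -(s * a₁ + t * a₂) = -s * D := by
      rw [hD_def]; ring
    rw [e₁, e₂] at h
    linear_combination h
  replace hD : D ≠ 0 := by
    rw [hD_def]; exact hD
  have hB : g 2 * -D + g 3 * (p₂ * b₁ - q₂ * a₁) = 0 := by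
    simpa [hD] using hev 1 0
  have hA : g 0 * D + g 1 * (p₁ * b₂ - q₁ * a₂) = 0 := by
    simpa [hD] using hev 0 1
  have hone : D ^ (n + 2) * (g 1 * (p₁ * b₁ - q₁ * a₁)) +
      (-D) ^ (n + 2) * (g 3 * (p₂ * b₂ - q₂ * a₂)) = 0 := by
    have h := hev 1 1
    simp only [one_mul, neg_mul] at h
    linear_combination h - D ^ (n + 2) * hA - (-D) ^ (n + 2) * hB
  have htwo : 2 ^ (n + 2) * D ^ (n + 2) * (g 1 * (p₁ * b₁ - q₁ * a₁)) +
      (-D) ^ (n + 2) * (2 * (g 3 * (p₂ * b₂ - q₂ * a₂))) = 0 := by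
    have h := hev 1 2
    simp only [one_mul, neg_mul, mul_pow] at h
    linear_combination h - 2 * 2 ^ (n + 2) * D ^ (n + 2) * hA - (-D) ^ (n + 2) * hB
  have hpow : (2 : ℂ) ^ (n + 2) - 2 ≠ 0 := by
    have h : 2 ^ (n + 2) ≠ 2 := by
      have := Nat.one_le_two_pow (n := n)
      rw [pow_add]; omega
    exact sub_ne_zero.mpr (by exact_mod_cast h)
  have h₁ : g 1 = 0 := by
    have h : (2 ^ (n + 2) - 2) * (D ^ (n + 2) * (g 1 * (p₁ * b₁ - q₁ * a₁))) = 0 := by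
      linear_combination htwo - 2 * hone
    simpa [hpow, hD, hM₁] using h
  have h₃ : g 3 = 0 := by
    simpa [h₁, hD, hM₂] using hone
  have h₀ : g 0 = 0 := by simpa [h₁, hD] using hA
  have h₂ : g 2 = 0 := by simpa [h₃, hD] using hB
  intro i
  fin_cases i
  exacts [h₀, h₁, h₂, h₃]
end

section
/- Let d ≥ 3. Let l₁, l₂ be nonzero linear binary forms over ℂ that are not proportional to each other, let m₁, m₂ be nonzero linear forms not proportional to each other, and let c₁, c₂, e₁, e₂ ∈ ℂ be all nonzero. If c₁l₁^d + c₂l₂^d = e₁m₁^d + e₂m₂^d in ℂ[X₀,X₁], then either (m₁ is proportional to l₁ and m₂ is proportional to l₂) or (m₁ is proportional to l₂ and m₂ is proportional to l₁). -/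
open MvPolynomial

lemma smul_linForm (c a b : ℂ) : c • linForm a b = linForm (c * a) (c * b) := by
  simp only [linForm, smul_eq_C_mul, C_mul]
  ring

lemma linForm_ne_zero {a b : ℂ} (h : (a, b) ≠ (0, 0)) : linForm a b ≠ 0 := by
  intro h0
  apply h
  have ha := congrArg (eval ![1, 0]) h0
  have hb := congrArg (eval ![0, 1]) h0
  simp [linForm] at ha hb
  simp [ha, hb]

/-- Linear forms with vanishing determinant are proportional. -/
lemma exists_linForm_eq_smul {a b p q : ℂ} (h : (a, b) ≠ (0, 0)) (hdet : a * q - b * p = 0) :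
    ∃ c : ℂ, linForm p q = c • linForm a b := by
  simp only [smul_linForm]
  by_cases ha : a = 0
  · have hb : b ≠ 0 := fun hb => h (by rw [ha, hb])
    have hp : p = 0 := by simpa [ha, hb] using hdet
    exact ⟨q / b, by rw [ha, hp, mul_zero, div_mul_cancel₀ q hb]⟩
  · refine ⟨p / a, ?_⟩
    rw [div_mul_cancel₀ p ha]
    congr 1
    field_simp
    linear_combination hdet

/-- The directional derivative annihilating `linForm u v`. -/
noncomputable def linFormDeriv (u v : ℂ) :
    Derivation ℂ (MvPolynomial (Fin 2) ℂ) (MvPolynomial (Fin 2) ℂ) :=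
  v • pderiv 0 - u • pderiv 1

lemma linFormDeriv_linForm (u v a b : ℂ) :
    linFormDeriv u v (linForm a b) = C (a * v - b * u) := by
  simp [linFormDeriv, linForm, pderiv_X, smul_eq_C_mul]
  ring

lemma linFormDeriv_smul_pow (u v a b c : ℂ) (n : ℕ) :
    linFormDeriv u v (c • linForm a b ^ (n + 1)) =
      (c * (n + 1) * (a * v - b * u)) • linForm a b ^ n := by
  rw [Derivation.map_smul, Derivation.leibniz_pow, linFormDeriv_linForm]
  simp [smul_eq_C_mul]
  ring

/-- If the power of a linear form is a combination of powers of three others, and it is not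
proportional to the first of these, then it is proportional to one of the last two. -/
lemma det_mul_det_eq_zero {d : ℕ} (hd : 3 ≤ d) {a₁ b₁ a₂ b₂ p₁ q₁ p₂ q₂ c₁ c₂ e₁ e₂ : ℂ}
    (hl₁ : (a₁, b₁) ≠ (0, 0)) (hc₁ : c₁ ≠ 0) (hdet : a₁ * b₂ - b₁ * a₂ ≠ 0)
    (heq : c₁ • (linForm a₁ b₁) ^ d + c₂ • (linForm a₂ b₂) ^ d
         = e₁ • (linForm p₁ q₁) ^ d + e₂ • (linForm p₂ q₂) ^ d) :
    a₁ * q₁ - b₁ * p₁ = 0 ∨ a₁ * q₂ - b₁ * p₂ = 0 := by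
  obtain ⟨n, rfl⟩ := Nat.exists_eq_add_of_le' hd
  have h := congrArg (fun f => linFormDeriv a₂ b₂ (linFormDeriv p₁ q₁ (linFormDeriv p₂ q₂ f))) heq
  simp only [map_add, linFormDeriv_smul_pow] at h
  have hself (x y : ℂ) : x * y - y * x = 0 := by ring
  simp only [hself, mul_zero, zero_mul, zero_smul, add_zero, smul_eq_zero,
    pow_eq_zero_iff', linForm_ne_zero hl₁, false_and, or_false, mul_eq_zero, hc₁, hdet,
    false_or, Nat.cast_add_one_ne_zero] at h
  tauto

/-- Uniqueness of the bi-secant decomposition: if `d ≥ 3`, `l₁, l₂` are nonzero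
non-proportional linear binary forms, `m₁, m₂` are nonzero non-proportional linear
forms, `c₁, c₂, e₁, e₂ ∈ ℂ*`, and `c₁l₁^d + c₂l₂^d = e₁m₁^d + e₂m₂^d`, then
`{[m₁], [m₂]} = {[l₁], [l₂]}` as sets of proportionality classes. -/
theorem bisecant_decomposition_unique
    (d : ℕ) (hd : 3 ≤ d)
    (a₁ b₁ a₂ b₂ p₁ q₁ p₂ q₂ : ℂ) (c₁ c₂ e₁ e₂ : ℂ)
    (hl₁ : (a₁, b₁) ≠ (0, 0)) (hl₂ : (a₂, b₂) ≠ (0, 0))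
    (hm₁ : (p₁, q₁) ≠ (0, 0)) (hm₂ : (p₂, q₂) ≠ (0, 0))
    (hl₁l₂ : ∀ c : ℂ, linForm a₁ b₁ ≠ c • linForm a₂ b₂)
    (hl₂l₁ : ∀ c : ℂ, linForm a₂ b₂ ≠ c • linForm a₁ b₁)
    (hm₁m₂ : ∀ c : ℂ, linForm p₁ q₁ ≠ c • linForm p₂ q₂)
    (hm₂m₁ : ∀ c : ℂ, linForm p₂ q₂ ≠ c • linForm p₁ q₁)
    (hc₁ : c₁ ≠ 0) (hc₂ : c₂ ≠ 0) (he₁ : e₁ ≠ 0) (he₂ : e₂ ≠ 0)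
    (heq : c₁ • (linForm a₁ b₁) ^ d + c₂ • (linForm a₂ b₂) ^ d
         = e₁ • (linForm p₁ q₁) ^ d + e₂ • (linForm p₂ q₂) ^ d) :
    ((∃ c : ℂ, linForm p₁ q₁ = c • linForm a₁ b₁) ∧
     (∃ c : ℂ, linForm p₂ q₂ = c • linForm a₂ b₂)) ∨
    ((∃ c : ℂ, linForm p₁ q₁ = c • linForm a₂ b₂) ∧
     (∃ c : ℂ, linForm p₂ q₂ = c • linForm a₁ b₁)) := by
  have hl : a₁ * b₂ - b₁ * a₂ ≠ 0 := fun h =>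
    let ⟨c, hc⟩ := exists_linForm_eq_smul hl₁ h
    hl₂l₁ c hc
  have hl' : a₂ * b₁ - b₂ * a₁ ≠ 0 := fun h => hl (by linear_combination -h)
  have hcommon {p q : ℂ} (hm : (p, q) ≠ (0, 0)) (h₁ : a₁ * q - b₁ * p = 0)
      (h₂ : a₂ * q - b₂ * p = 0) : False := by
    have hp : (a₁ * b₂ - b₁ * a₂) * p = 0 := by linear_combination a₂ * h₁ - a₁ * h₂
    have hq : (a₁ * b₂ - b₁ * a₂) * q = 0 := by linear_combination b₂ * h₁ - b₁ * h₂
    exact hm (by rw [(mul_eq_zero.mp hp).resolve_left hl, (mul_eq_zero.mp hq).resolve_left hl])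
  have h₁ := det_mul_det_eq_zero hd hl₁ hc₁ hl heq
  have h₂ := det_mul_det_eq_zero hd hl₂ hc₂ hl' ((add_comm _ _).trans heq)
  rcases h₁ with h₁ | h₁
  · exact .inl ⟨exists_linForm_eq_smul hl₁ h₁,
      exists_linForm_eq_smul hl₂ (h₂.resolve_left (hcommon hm₁ h₁))⟩
  · exact .inr ⟨exists_linForm_eq_smul hl₂ (h₂.resolve_right (hcommon hm₂ h₁)),
      exists_linForm_eq_smul hl₁ h₁⟩
end
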